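/- arXiv:1606.02867 — 6 statements merged into one kernel-verified Lean document; each statement's English description precedes it below -/
import Mathlib

section
/- Let c, I, S be real numbers with 0 < c, 0 < I, c ≤ I and 0 ≤ S. Then log₂(1 + (S + I)/c) − log₂(1 + S/I) ≥ log₂(I/c) ≥ 0; in particular log₂(1 + (S + I)/c) ≥ log₂(1 + S/I). -/
/-- Proposition 4 (deterministic form): if `0 < c ≤ I` and `0 ≤ S`, then
`log₂(1 + (S + I)/c) − log₂(1 + S/I) ≥ log₂(I/c) ≥ 0`, and in particular
`log₂(1 + (S + I)/c) ≥ log₂(1 + S/I)`. -/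
theorem coop_rate_ge_noncoop_rate (c I S : ℝ) (hc : 0 < c) (hI : 0 < I)
    (hcI : c ≤ I) (hS : 0 ≤ S) :
    Real.logb 2 (1 + (S + I) / c) - Real.logb 2 (1 + S / I) ≥ Real.logb 2 (I / c) ∧
    Real.logb 2 (I / c) ≥ 0 ∧
    Real.logb 2 (1 + (S + I) / c) ≥ Real.logb 2 (1 + S / I) := by
  have h1 : 0 < I / c := div_pos hI hc
  have h2 : 0 < 1 + S / I := by positivity
  have h3 : Real.logb 2 (I / c) ≥ 0 :=
    Real.logb_nonneg (by norm_num) ((one_le_div hc).2 hcI)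
  have h4 : I / c * (1 + S / I) = (S + I) / c := by
    field_simp
    ring
  have h5 : Real.logb 2 (I / c * (1 + S / I)) ≤ Real.logb 2 (1 + (S + I) / c) :=
    Real.logb_le_logb_of_le (by norm_num) (mul_pos h1 h2) (by rw [h4]; linarith)
  rw [Real.logb_mul h1.ne' h2.ne'] at h5
  exact ⟨by linarith, h3, by linarith⟩
end

section
/- Let q and M be real numbers with 0 < q < 1 and M > 0. Then the function x ↦ (1 − qˣ)^{M/x} (real powers) is monotone nondecreasing on (0, ∞); that is, for all real x, y with 0 < x ≤ y one has (1 − qˣ)^{M/x} ≤ (1 − q^y)^{M/y}. -/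
/-- For `0 < q < 1` and `M > 0`, the function `x ↦ (1 − qˣ)^(M/x)` (real powers)
is nondecreasing on `(0, ∞)`. -/
theorem hit_prob_all_clusters_monotone (q M : ℝ) (hq0 : 0 < q) (hq1 : q < 1)
    (hM : 0 < M) :
    ∀ x y : ℝ, 0 < x → x ≤ y →
      (1 - q ^ x) ^ (M / x) ≤ (1 - q ^ y) ^ (M / y) := by
  intro x y hx hxy
  have hy : 0 < y := lt_of_lt_of_le hx hxy
  have h1 : q ^ y ≤ q ^ x := Real.rpow_le_rpow_of_exponent_ge hq0 hq1.le hxy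
  have h2 : q ^ x < 1 := Real.rpow_lt_one hq0.le hq1 hx
  have h3 : 0 < q ^ y := Real.rpow_pos_of_pos hq0 y
  have h4 : M / y ≤ M / x := div_le_div_of_nonneg_left hM.le hx hxy
  calc (1 - q ^ x) ^ (M / x) ≤ (1 - q ^ y) ^ (M / x) :=
        Real.rpow_le_rpow (by linarith) (by linarith) (by positivity)
    _ ≤ (1 - q ^ y) ^ (M / y) :=
        Real.rpow_le_rpow_of_exponent_ge (by linarith) (by linarith) h4
end

section
/- Let M be a real number with M > 0 and let p : ℕ → ℝ satisfy 0 < p k < 1 for every k. For positive integers K and K′ with K ≤ K′, one has 1 − ∏_{k=1}^{K} (1 − (1 − (1 − p k)^K)^{M/K}) ≤ 1 − ∏_{k=1}^{K′} (1 − (1 − (1 − p k)^{K′})^{M/K′}), where the inner exponents K, K′ are natural-number powers and the outer exponents M/K, M/K′ are real powers. -/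
/-- The cooperative probability `P^c(K) = 1 − ∏_{k=1}^{K} (1 − (1 − (1 − p k)^K)^(M/K))`
is nondecreasing in the cluster size `K` for a fixed total number `M` of users. -/
theorem coop_prob_monotone (M : ℝ) (hM : 0 < M) (p : ℕ → ℝ)
    (hp : ∀ k, 0 < p k ∧ p k < 1) (K K' : ℕ) (hK : 0 < K) (hKK' : K ≤ K') :
    1 - ∏ k ∈ Finset.Icc 1 K, (1 - (1 - (1 - p k) ^ K) ^ (M / (K : ℝ))) ≤
      1 - ∏ k ∈ Finset.Icc 1 K', (1 - (1 - (1 - p k) ^ K') ^ (M / (K' : ℝ))) := by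
  have hK' : 0 < K' := lt_of_lt_of_le hK hKK'
  have hb : ∀ n : ℕ, 0 < n → ∀ k, 0 < 1 - (1 - p k) ^ n ∧ 1 - (1 - p k) ^ n ≤ 1 := by
    intro n hn k
    obtain ⟨h0, h1⟩ := hp k
    have h2 : (1 - p k) ^ n < 1 := pow_lt_one₀ (by linarith) (by linarith) hn.ne'
    have h3 : 0 ≤ (1 - p k) ^ n := pow_nonneg (by linarith) n
    constructor <;> linarith
  have hf : ∀ n : ℕ, 0 < n → ∀ k, 0 ≤ 1 - (1 - (1 - p k) ^ n) ^ (M / (n : ℝ)) ∧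
      1 - (1 - (1 - p k) ^ n) ^ (M / (n : ℝ)) ≤ 1 := by
    intro n hn k
    obtain ⟨h0, h1⟩ := hb n hn k
    have h2 := Real.rpow_le_one h0.le h1 (z := M / (n : ℝ)) (by positivity)
    have h3 := Real.rpow_nonneg h0.le (M / (n : ℝ))
    constructor <;> linarith
  apply sub_le_sub_left
  calc ∏ k ∈ Finset.Icc 1 K', (1 - (1 - (1 - p k) ^ K') ^ (M / (K' : ℝ)))
      ≤ ∏ k ∈ Finset.Icc 1 K, (1 - (1 - (1 - p k) ^ K') ^ (M / (K' : ℝ))) := by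
        rw [← Finset.prod_sdiff (Finset.Icc_subset_Icc_right (a := 1) hKK')]
        apply mul_le_of_le_one_left
        · exact Finset.prod_nonneg fun k _ => (hf K' hK' k).1
        · exact Finset.prod_le_one (fun k _ => (hf K' hK' k).1) (fun k _ => (hf K' hK' k).2)
    _ ≤ _ := by
        apply Finset.prod_le_prod (fun k _ => (hf K' hK' k).1)
        intro k _
        apply sub_le_sub_left
        have hKr : (0 : ℝ) < K := by exact_mod_cast hK
        have hle : (K : ℝ) ≤ K' := by exact_mod_cast hKK'
        have h1 : M / (K' : ℝ) ≤ M / (K : ℝ) := div_le_div_of_nonneg_left hM.le hKr hle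
        have h2 : (1 - p k) ^ K' ≤ (1 - p k) ^ K :=
          pow_le_pow_of_le_one (by linarith [hp k]) (by linarith [hp k]) hKK'
        exact (Real.rpow_le_rpow_of_exponent_ge (hb K hK k).1 (hb K hK k).2 h1).trans
          (Real.rpow_le_rpow (hb K hK k).1.le (by linarith) (by positivity))
end

section
/- For every real number r with 0 ≤ r ≤ 1, the 4-dimensional Lebesgue measure of the set {(x₁, y₁, x₂, y₂) ∈ [0,1]⁴ : (1 + x₂ − x₁)² + (y₁ − y₂)² ≤ r²} equals (2/3)r³ − (1/4)r⁴. -/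
open MeasureTheory Set

noncomputable def II : ℝ → ENNReal := (Icc (0:ℝ) 1).indicator 1

lemma II_meas : Measurable II := measurable_one.indicator measurableSet_Icc

lemma tri (g : ℝ → ENNReal) (hg : Measurable g) :
    ∫⁻ x, ∫⁻ y, II x * II y * g (x - y) = ∫⁻ v, ENNReal.ofReal (1 - |v|) * g v := by
  have hm := II_meas
  have h1 : ∀ x : ℝ, ∫⁻ y, II x * II y * g (x - y) = ∫⁻ v, II x * II (x - v) * g v := by
    intro x
    rw [← lintegral_sub_left_eq_self (fun y => II x * II y * g (x - y)) x]
    simp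
  simp_rw [h1]
  rw [lintegral_lintegral_swap (by fun_prop)]
  congr 1; ext v
  rw [lintegral_mul_const _ (by fun_prop)]
  congr 1
  have : (fun x => II x * II (x - v)) = (Icc (max 0 v) (min 1 (1 + v))).indicator 1 := by
    ext x
    simp only [II, indicator_apply, mem_Icc, max_le_iff, le_min_iff, Pi.one_apply]
    have e : ((0 ≤ x ∧ v ≤ x) ∧ x ≤ 1 ∧ x ≤ 1 + v) ↔
        ((0 ≤ x ∧ x ≤ 1) ∧ (0 ≤ x - v ∧ x - v ≤ 1)) := by
      constructor
      · rintro ⟨⟨a, b⟩, c, d⟩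
        exact ⟨⟨a, c⟩, by linarith, by linarith⟩
      · rintro ⟨⟨a, b⟩, c, d⟩
        exact ⟨⟨a, by linarith⟩, b, by linarith⟩
    simp only [e, ite_and, mul_ite, ite_mul, one_mul, zero_mul]
    split_ifs <;> simp
  rw [this, lintegral_indicator_one measurableSet_Icc, Real.volume_Icc]
  congr 1
  rcases le_total 0 v with h | h
  · rw [abs_of_nonneg h, max_eq_right h, min_eq_left (by linarith)]
  · rw [abs_of_nonpos h, max_eq_left h, min_eq_right (by linarith)]; ring

noncomputable def kk (c t : ℝ) : ENNReal := {t : ℝ | (1 - t) ^ 2 ≤ c}.indicator 1 t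

lemma inner (c : ℝ) (hc : c ≤ 1) :
    ∫⁻ t, ENNReal.ofReal (1 - |t|) * kk c t = ENNReal.ofReal (c / 2) := by
  rcases lt_or_ge c 0 with h | h
  · rw [ENNReal.ofReal_of_nonpos (by linarith)]
    have : ∀ t, kk c t = 0 := by
      intro t
      simp only [kk, indicator_apply, mem_ofPred_eq]
      rw [if_neg]; nlinarith [sq_nonneg (1 - t)]
    simp [this]
  · set s := √c with hs
    have hs0 : 0 ≤ s := Real.sqrt_nonneg _
    have hss : s ^ 2 = c := Real.sq_sqrt h
    have hs1 : s ≤ 1 := by nlinarith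
    have : ∀ t, ENNReal.ofReal (1 - |t|) * kk c t
        = (Icc (1 - s) 1).indicator (fun t => ENNReal.ofReal (1 - t)) t := by
      intro t
      simp only [kk, indicator_apply, mem_ofPred_eq, mem_Icc, Pi.one_apply]
      by_cases h1 : 1 - s ≤ t ∧ t ≤ 1
      · rw [if_pos h1, if_pos (by nlinarith [h1.1, h1.2]), abs_of_nonneg (by linarith [h1.1]), mul_one]
      · rw [if_neg h1]
        rw [mul_eq_zero]
        by_cases h2 : t ≤ 1
        · right
          rw [if_neg]
          intro h3
          exact h1 ⟨by nlinarith [abs_le_of_sq_le_sq' (hss ▸ h3) hs0], h2⟩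
        · left
          exact ENNReal.ofReal_of_nonpos (by linarith [le_abs_self t])
    simp_rw [this]
    rw [lintegral_indicator measurableSet_Icc, ← ofReal_integral_eq_lintegral_ofReal]
    · rw [integral_Icc_eq_integral_Ioc, ← intervalIntegral.integral_of_le (by linarith)]
      congr 1
      rw [intervalIntegral.integral_sub (by simp) (by simp)]
      simp only [integral_id, intervalIntegral.integral_const, smul_eq_mul]
      rw [← hss]; ring
    · exact (by fun_prop : Continuous fun t : ℝ => 1 - t).integrableOn_Icc
    · refine (ae_restrict_iff' measurableSet_Icc).2 (ae_of_all _ fun t ht => ?_)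
      simpa using ht.2

lemma outer (r : ℝ) (hr0 : 0 ≤ r) (hr1 : r ≤ 1) :
    ∫⁻ v, ENNReal.ofReal (1 - |v|) * ENNReal.ofReal ((r ^ 2 - v ^ 2) / 2)
      = ENNReal.ofReal (2 / 3 * r ^ 3 - 1 / 4 * r ^ 4) := by
  have : ∀ v, ENNReal.ofReal (1 - |v|) * ENNReal.ofReal ((r ^ 2 - v ^ 2) / 2)
      = (Icc (-r) r).indicator (fun v => ENNReal.ofReal ((1 - |v|) * ((r ^ 2 - v ^ 2) / 2))) v := by
    intro v
    simp only [indicator_apply, mem_Icc]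
    by_cases h : -r ≤ v ∧ v ≤ r
    · rw [if_pos h, ENNReal.ofReal_mul]
      linarith [abs_le.2 h]
    · rw [if_neg h, mul_eq_zero]
      right
      apply ENNReal.ofReal_of_nonpos
      rw [← abs_le, not_le] at h
      nlinarith [sq_abs v]
  simp_rw [this]
  rw [lintegral_indicator measurableSet_Icc, ← ofReal_integral_eq_lintegral_ofReal]
  · rw [integral_Icc_eq_integral_Ioc, ← intervalIntegral.integral_of_le (by linarith)]
    congr 1
    have hc : Continuous fun v : ℝ => (1 - |v|) * ((r ^ 2 - v ^ 2) / 2) := by fun_prop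
    rw [← intervalIntegral.integral_add_adjacent_intervals (b := 0)
      (hc.intervalIntegrable _ _) (hc.intervalIntegrable _ _)]
    have e1 : ∫ v in (-r)..0, (1 - |v|) * ((r ^ 2 - v ^ 2) / 2)
        = ∫ v in (0:ℝ)..r, (1 - |v|) * ((r ^ 2 - v ^ 2) / 2) := by
      have := intervalIntegral.integral_comp_neg (a := 0) (b := r)
        (fun v : ℝ => (1 - |v|) * ((r ^ 2 - v ^ 2) / 2))
      simp only [abs_neg, neg_sq, neg_zero] at this
      exact this.symm
    have e2 : ∫ v in (0:ℝ)..r, (1 - |v|) * ((r ^ 2 - v ^ 2) / 2)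
        = 1 / 3 * r ^ 3 - 1 / 8 * r ^ 4 := by
      have hd : ∀ v ∈ uIcc 0 r, HasDerivAt
          (fun v : ℝ => r ^ 2 / 2 * v - r ^ 2 / 4 * v ^ 2 - v ^ 3 / 6 + v ^ 4 / 8)
          ((1 - |v|) * ((r ^ 2 - v ^ 2) / 2)) v := by
        intro v hv
        rw [uIcc_of_le hr0] at hv
        rw [abs_of_nonneg hv.1]
        have := ((((hasDerivAt_id v).const_mul (r ^ 2 / 2)).sub
          ((hasDerivAt_pow 2 v).const_mul (r ^ 2 / 4))).sub
          ((hasDerivAt_pow 3 v).div_const 6)).add ((hasDerivAt_pow 4 v).div_const 8)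
        refine this.congr_deriv ?_
        norm_num
        ring
      rw [intervalIntegral.integral_eq_sub_of_hasDerivAt hd (hc.intervalIntegrable _ _)]
      ring
    rw [e1, e2]; ring
  · exact (by fun_prop : Continuous fun v : ℝ => (1 - |v|) * ((r ^ 2 - v ^ 2) / 2)).integrableOn_Icc
  · refine (ae_restrict_iff' measurableSet_Icc).2 (ae_of_all _ fun t ht => ?_)
    have := abs_le.2 ht
    exact mul_nonneg (by linarith) (by nlinarith [sq_abs t, abs_nonneg t])



/-- Equation (A.10): for `0 ≤ r ≤ 1`, the probability that a point uniform in the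
unit square and a point uniform in the horizontally adjacent unit square are within
normalized distance `r` is `(2/3)r³ − (1/4)r⁴`, stated as a 4-dimensional Lebesgue
volume. -/
theorem adjacent_square_distance_cdf_small (r : ℝ) (hr0 : 0 ≤ r) (hr1 : r ≤ 1) :
    volume {p : ℝ × ℝ × ℝ × ℝ |
        p.1 ∈ Set.Icc (0 : ℝ) 1 ∧ p.2.1 ∈ Set.Icc (0 : ℝ) 1 ∧
        p.2.2.1 ∈ Set.Icc (0 : ℝ) 1 ∧ p.2.2.2 ∈ Set.Icc (0 : ℝ) 1 ∧
        (1 + p.2.2.1 - p.1) ^ 2 + (p.2.1 - p.2.2.2) ^ 2 ≤ r ^ 2} =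
      ENNReal.ofReal (2 / 3 * r ^ 3 - 1 / 4 * r ^ 4) := by

  have hm := II_meas
  set K : ℝ → ℝ → ENNReal := fun t v => kk (r ^ 2 - v ^ 2) t with hK
  have hKm : Measurable (fun p : ℝ × ℝ => K p.1 p.2) := by
    have : (fun p : ℝ × ℝ => K p.1 p.2)
        = {p : ℝ × ℝ | (1 - p.1) ^ 2 ≤ r ^ 2 - p.2 ^ 2}.indicator 1 := by
      ext p; simp [hK, kk, indicator_apply]
    rw [this]
    exact measurable_one.indicator (measurableSet_le (by fun_prop) (by fun_prop))
  have hK' : ∀ {α : Type} [MeasurableSpace α] (f g : α → ℝ), Measurable f → Measurable g →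
      Measurable fun a => K (f a) (g a) := fun f g hf hg => hKm.comp (hf.prodMk hg)
  set F : ℝ × ℝ × ℝ × ℝ → ENNReal := fun p =>
    (II p.2.1 * II p.2.2.2) * (II p.1 * II p.2.2.1 * K (p.1 - p.2.2.1) (p.2.1 - p.2.2.2)) with hF
  have hFm : Measurable F := by
    have := hK' (fun p : ℝ × ℝ × ℝ × ℝ => p.1 - p.2.2.1) (fun p => p.2.1 - p.2.2.2)
      (by fun_prop) (by fun_prop)
    fun_prop
  have hS : MeasurableSet {p : ℝ × ℝ × ℝ × ℝ |
        p.1 ∈ Set.Icc (0 : ℝ) 1 ∧ p.2.1 ∈ Set.Icc (0 : ℝ) 1 ∧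
        p.2.2.1 ∈ Set.Icc (0 : ℝ) 1 ∧ p.2.2.2 ∈ Set.Icc (0 : ℝ) 1 ∧
        (1 + p.2.2.1 - p.1) ^ 2 + (p.2.1 - p.2.2.2) ^ 2 ≤ r ^ 2} := by
    refine (measurableSet_Icc.preimage (by fun_prop)).inter
      ((measurableSet_Icc.preimage (by fun_prop)).inter
      ((measurableSet_Icc.preimage (by fun_prop)).inter
      ((measurableSet_Icc.preimage (by fun_prop)).inter
      (measurableSet_le
        (f := fun p : ℝ × ℝ × ℝ × ℝ => (1 + p.2.2.1 - p.1) ^ 2 + (p.2.1 - p.2.2.2) ^ 2)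
        (g := fun _ => r ^ 2) (by fun_prop) (by fun_prop)))))
  rw [← lintegral_indicator_one hS]
  have hFi : ∀ p, indicator {p : ℝ × ℝ × ℝ × ℝ |
        p.1 ∈ Set.Icc (0 : ℝ) 1 ∧ p.2.1 ∈ Set.Icc (0 : ℝ) 1 ∧
        p.2.2.1 ∈ Set.Icc (0 : ℝ) 1 ∧ p.2.2.2 ∈ Set.Icc (0 : ℝ) 1 ∧
        (1 + p.2.2.1 - p.1) ^ 2 + (p.2.1 - p.2.2.2) ^ 2 ≤ r ^ 2} 1 p = F p := by
    rintro ⟨a, b, c, d⟩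
    have e : (1 - (a - c)) ^ 2 ≤ r ^ 2 - (b - d) ^ 2 ↔ (1 + c - a) ^ 2 + (b - d) ^ 2 ≤ r ^ 2 := by
      rw [le_sub_iff_add_le, show 1 - (a - c) = 1 + c - a by ring]
    simp only [hF, hK, II, kk, indicator_apply, mem_ofPred_eq, e, Pi.one_apply]
    by_cases h1 : a ∈ Icc (0:ℝ) 1 <;> by_cases h2 : b ∈ Icc (0:ℝ) 1 <;>
      by_cases h3 : c ∈ Icc (0:ℝ) 1 <;> by_cases h4 : d ∈ Icc (0:ℝ) 1 <;>
      simp only [h1, h2, h3, h4, true_and, false_and, and_false, if_true, if_false, mul_one,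
        one_mul, mul_zero, zero_mul]
  simp_rw [hFi]
  have hG : ∀ b d : ℝ, ∫⁻ a, ∫⁻ c, F (a, b, c, d)
      = II b * II d * ENNReal.ofReal ((r ^ 2 - (b - d) ^ 2) / 2) := by
    intro b d
    have hk : Measurable fun t => K t (b - d) := hK' _ _ measurable_id measurable_const
    have := tri (fun t => K t (b - d)) hk
    simp only [hK] at this
    rw [inner _ (by nlinarith [sq_nonneg (b - d)])] at this
    rw [← this]
    have hm2 : Measurable fun q : ℝ × ℝ => II q.1 * II q.2 * K (q.1 - q.2) (b - d) := by
      have := hK' (fun q : ℝ × ℝ => q.1 - q.2) (fun _ => b - d) (by fun_prop) (by fun_prop)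
      fun_prop
    rw [← lintegral_const_mul _ hm2.lintegral_prod_right']
    congr 1; ext a
    have hm3 : Measurable fun y : ℝ => II a * II y * K (a - y) (b - d) :=
      hm2.comp (measurable_const.prodMk measurable_id)
    exact lintegral_const_mul (II b * II d) hm3
  calc ∫⁻ p, F p = ∫⁻ a, ∫⁻ q : ℝ × ℝ × ℝ, F (a, q) := by
        rw [Measure.volume_eq_prod, lintegral_prod _ hFm.aemeasurable]
    _ = ∫⁻ q : ℝ × ℝ × ℝ, ∫⁻ a, F (a, q) :=
        lintegral_lintegral_swap (by exact hFm.aemeasurable)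
    _ = ∫⁻ b, ∫⁻ z : ℝ × ℝ, ∫⁻ a, F (a, b, z) := by
        have : Measurable fun q : ℝ × ℝ × ℝ => ∫⁻ a, F (a, q) := hFm.lintegral_prod_left'
        rw [Measure.volume_eq_prod, lintegral_prod _ this.aemeasurable]
    _ = ∫⁻ b, ∫⁻ d, ∫⁻ c, ∫⁻ a, F (a, b, c, d) := by
        congr 1; ext b
        have : Measurable fun z : ℝ × ℝ => ∫⁻ a, F (a, b, z) :=
          (hFm.lintegral_prod_left' (μ := volume)).comp (measurable_const.prodMk measurable_id)
        rw [Measure.volume_eq_prod, lintegral_prod_symm _ this.aemeasurable]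
    _ = ∫⁻ b, ∫⁻ d, II b * II d * ENNReal.ofReal ((r ^ 2 - (b - d) ^ 2) / 2) := by
        congr 1; ext b; congr 1; ext d
        rw [← hG, lintegral_lintegral_swap]
        exact (hFm.comp (by fun_prop :
          Measurable fun q : ℝ × ℝ => (q.2, b, q.1, d))).aemeasurable
    _ = _ := by
        rw [tri (fun v => ENNReal.ofReal ((r ^ 2 - v ^ 2) / 2)) (by fun_prop), outer r hr0 hr1]
end

section
/- For every real number r with √2 ≤ r ≤ 2, the 4-dimensional Lebesgue measure of the set {(x₁, y₁, x₂, y₂) ∈ [0,1]⁴ : (1 + x₂ − x₁)² + (y₁ − y₂)² ≤ r²} equals −11/12 + 2√(r² − 1) − r²/2 + 2 r² arcsin(1/r) + (4/3)((r² − 1)^{3/2} − r³). -/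
open MeasureTheory

lemma aux_tri (f : ℝ → ENNReal) (hf : Measurable f) :
    ∫⁻ x in Set.Icc (0:ℝ) 1, ∫⁻ y in Set.Icc (0:ℝ) 1, f (y - x)
      = ∫⁻ u, ENNReal.ofReal (1 - |u|) * f u := by
  have h1 : ∀ x : ℝ, ∫⁻ y in Set.Icc (0:ℝ) 1, f (y - x)
      = ∫⁻ u, (Set.Icc (0:ℝ) 1).indicator 1 (u + x) * f u := by
    intro x
    rw [← lintegral_indicator measurableSet_Icc,
      ← lintegral_add_right_eq_self _ x]
    refine lintegral_congr fun u => ?_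
    by_cases h : u + x ∈ Set.Icc (0:ℝ) 1
    · simp only [Set.indicator_of_mem h]; simp
    · simp only [Set.indicator_of_notMem h]; simp
  simp_rw [h1]
  have hm : Measurable ((Set.Icc (0:ℝ) 1).indicator (1 : ℝ → ENNReal)) :=
    measurable_one.indicator measurableSet_Icc
  rw [lintegral_lintegral_swap]
  · refine lintegral_congr fun u => ?_
    rw [lintegral_mul_const _ (by fun_prop)]
    congr 1
    have : (fun x : ℝ => (Set.Icc (0:ℝ) 1).indicator (1 : ℝ → ENNReal) (u + x))
        = (Set.Icc (-u) (1-u)).indicator 1 := by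
      funext x
      have : u + x ∈ Set.Icc (0:ℝ) 1 ↔ x ∈ Set.Icc (-u) (1-u) := by
        simp only [Set.mem_Icc]
        constructor <;> rintro ⟨h, h'⟩ <;> constructor <;> linarith
      simp only [Set.indicator_apply, this, Pi.one_apply]
    rw [this, lintegral_indicator_one measurableSet_Icc, Measure.restrict_apply measurableSet_Icc,
      Set.Icc_inter_Icc, Real.volume_Icc]
    congr 1
    rcases le_total 0 u with h | h
    · rw [abs_of_nonneg h, max_eq_right (by linarith), min_eq_left (by linarith)]; ring
    · rw [abs_of_nonpos h, max_eq_left (by linarith), min_eq_right (by linarith)]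
  · apply Measurable.aemeasurable
    unfold Function.uncurry
    fun_prop

lemma aux_int_abs (m : ℝ) (hm : 0 ≤ m) :
    ∫ v in (-m)..m, (1 - |v|) = 2 * m - m ^ 2 := by
  have hi : ∀ a b : ℝ, IntervalIntegrable (fun v : ℝ => 1 - |v|) volume a b :=
    fun a b => Continuous.intervalIntegrable (by fun_prop) a b
  rw [← intervalIntegral.integral_add_adjacent_intervals (hi (-m) 0) (hi 0 m)]
  have h1 : ∫ v in (-m)..0, (1 - |v|) = ∫ v in (-m)..0, (1 + v) := by
    apply intervalIntegral.integral_congr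
    intro v hv
    rw [Set.uIcc_of_le (by linarith)] at hv
    simp only [abs_of_nonpos hv.2]; ring
  have h2 : ∫ v in (0:ℝ)..m, (1 - |v|) = ∫ v in (0:ℝ)..m, (1 - v) := by
    apply intervalIntegral.integral_congr
    intro v hv
    rw [Set.uIcc_of_le (by linarith)] at hv
    simp only [abs_of_nonneg hv.1]
  rw [h1, h2, intervalIntegral.integral_add (by simp) (by simp),
    intervalIntegral.integral_sub (by simp) (by simp)]
  simp
  ring

lemma aux_inner (c : ℝ) :
    ∫⁻ v : ℝ, ENNReal.ofReal (1 - |v|) * {v : ℝ | v ^ 2 ≤ c}.indicator 1 v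
      = ENNReal.ofReal (2 * √(min c 1) - √(min c 1) ^ 2) := by
  set m := √(min c 1) with hm
  have hm0 : 0 ≤ m := Real.sqrt_nonneg _
  have hm1 : m ≤ 1 := by
    rw [hm]; exact Real.sqrt_le_one.mpr (min_le_right _ _) 
  rw [← aux_int_abs m hm0, intervalIntegral.integral_of_le (by linarith),
    ofReal_integral_eq_lintegral_ofReal, ← lintegral_indicator measurableSet_Ioc]
  · apply lintegral_congr_ae
    have h0 : ∀ᵐ v : ℝ, v ≠ 0 := by simp [ae_iff]
    have h1 : ∀ᵐ v : ℝ, v ≠ -m := by simp [ae_iff]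
    filter_upwards [h0, h1] with v hv0 hv1
    by_cases hv : |v| < 1
    · have : v ^ 2 ≤ c ↔ v ∈ Set.Ioc (-m) m := by
        have e1 : v ^ 2 ≤ c ↔ v ^ 2 ≤ min c 1 := by
          rw [le_min_iff]
          have : v ^ 2 ≤ 1 := by rw [sq_le_one_iff_abs_le_one]; exact hv.le
          tauto
        have e2 : v ^ 2 ≤ min c 1 ↔ |v| ≤ m := by
          rw [hm, Real.le_sqrt' (abs_pos.mpr hv0), sq_abs]
        rw [e1, e2, abs_le, Set.mem_Ioc]
        constructor
        · rintro ⟨h, h'⟩; exact ⟨lt_of_le_of_ne h (Ne.symm hv1), h'⟩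
        · rintro ⟨h, h'⟩; exact ⟨h.le, h'⟩
      simp only [Set.indicator_apply, Set.mem_ofPred_eq, this]
      split_ifs <;> simp
    · have : ENNReal.ofReal (1 - |v|) = 0 := ENNReal.ofReal_of_nonpos (by linarith)
      simp [Set.indicator_apply, this]
  · exact (Continuous.integrableOn_Icc (by fun_prop)).mono_set Set.Ioc_subset_Icc_self
  · refine (ae_restrict_mem measurableSet_Ioc).mono fun v hv => ?_
    have : |v| ≤ m := abs_le.mpr ⟨hv.1.le, hv.2⟩
    simp; linarith

lemma aux_real (r : ℝ) (hr0 : √2 ≤ r) (hr1 : r ≤ 2) :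
    ∫ u in (-1:ℝ)..1, (1 - |u|) * (2 * √(min (r^2 - (1+u)^2) 1) - √(min (r^2 - (1+u)^2) 1) ^ 2)
     = -11 / 12 + 2 * √(r ^ 2 - 1) - r ^ 2 / 2 +
        2 * r ^ 2 * Real.arcsin (1 / r) +
        4 / 3 * ((r ^ 2 - 1) ^ ((3 : ℝ) / 2) - r ^ 3) := by
  have hrpos : 0 < r := lt_of_lt_of_le (by positivity) hr0
  have hr2 : 2 ≤ r ^ 2 := by
    have := Real.sq_sqrt (show (0:ℝ) ≤ 2 by norm_num)
    have h0 := Real.sqrt_nonneg 2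
    nlinarith
  set a := √(r ^ 2 - 1) with ha
  have ha2 : a ^ 2 = r ^ 2 - 1 := Real.sq_sqrt (by linarith)
  have ha1 : 1 ≤ a := Real.one_le_sqrt.mpr (by linarith)
  have har : a ≤ r := by nlinarith
  have hpow : (r ^ 2 - 1) ^ ((3 : ℝ) / 2) = a ^ 3 := by
    rw [ha, Real.sqrt_eq_rpow, ← Real.rpow_mul_natCast (by linarith)]
    norm_num
  rw [hpow]
  set F : ℝ → ℝ := fun u => (1 - |u|) * (2 * √(min (r^2 - (1+u)^2) 1) - √(min (r^2 - (1+u)^2) 1) ^ 2) with hF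
  have hi : ∀ x y : ℝ, IntervalIntegrable F volume x y :=
    fun x y => Continuous.intervalIntegrable (by fun_prop) x y
  rw [← intervalIntegral.integral_add_adjacent_intervals (hi (-1) (r-1)) (hi (r-1) 1),
    ← intervalIntegral.integral_add_adjacent_intervals (hi (-1) (a-1)) (hi (a-1) (r-1)),
    ← intervalIntegral.integral_add_adjacent_intervals (hi (-1) 0) (hi 0 (a-1))]
  have h1 : ∫ u in (-1:ℝ)..0, F u = ∫ u in (-1:ℝ)..0, (1 + u) := by
    apply intervalIntegral.integral_congr
    intro u hu
    rw [Set.uIcc_of_le (by linarith)] at hu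
    simp only [hF, abs_of_nonpos hu.2]
    rw [min_eq_right (by nlinarith [hu.1, hu.2])]; simp; ring
  have h2 : ∫ u in (0:ℝ)..(a-1), F u = ∫ u in (0:ℝ)..(a-1), (1 - u) := by
    apply intervalIntegral.integral_congr
    intro u hu
    rw [Set.uIcc_of_le (by linarith)] at hu
    simp only [hF, abs_of_nonneg hu.1]
    rw [min_eq_right (by nlinarith [hu.1, hu.2])]; simp; ring
  have h4 : ∫ u in (r-1)..1, F u = 0 := by
    rw [intervalIntegral.integral_congr (g := fun _ => (0:ℝ))]
    · simp
    intro u hu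
    rw [Set.uIcc_of_le (by linarith)] at hu
    have : r^2 - (1+u)^2 ≤ 0 := by nlinarith [hu.1, hu.2]
    simp only [hF]
    rw [min_eq_left (by linarith), Real.sqrt_eq_zero_of_nonpos this]; simp
  have h3 : ∫ u in (a-1)..(r-1), F u = -5/12 + 4/3*a^3 - 4/3*r^3 + 2 * r^2 * Real.arcsin (1/r) := by
    set A : ℝ → ℝ := fun u => 2 * ((1+u) * √(r^2-(1+u)^2) + r^2 * Real.arcsin ((1+u)/r))
      + 2/3 * (√(r^2-(1+u)^2))^3 - 2*r^2*(1+u) + 2/3*(1+u)^3 + r^2*(1+u)^2/2 - (1+u)^4/4 with hA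
    rw [intervalIntegral.integral_eq_sub_of_hasDerivAt_of_le (f := A) (by linarith) _ _ (hi _ _)]
    · have e1 : √(r^2 - (1+(r-1))^2) = 0 := by
        rw [show r^2 - (1+(r-1))^2 = 0 by ring]; simp
      have e2 : √(r^2 - (1+(a-1))^2) = 1 := by
        rw [show r^2 - (1+(a-1))^2 = 1 by ring_nf; linarith]; simp
      have e3 : Real.arcsin ((1+(r-1))/r) = Real.pi/2 := by
        rw [show (1+(r-1))/r = 1 by field_simp; ring]; simp
      have e4 : Real.arcsin ((1+(a-1))/r) = Real.pi/2 - Real.arcsin (1/r) := by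
        rw [← Real.arccos_eq_pi_div_two_sub_arcsin, Real.arccos_eq_arcsin (by positivity)]
        congr 1
        rw [show 1 - (1/r)^2 = (a/r)^2 by field_simp; linarith, Real.sqrt_sq (by positivity)]
        ring
      simp only [hA, e1, e2, e3, e4]
      have : r^2 = a^2+1 := by linarith
      have h4 : r^4 = (a^2+1)^2 := by rw [← this]; ring
      have h3 : r^3 = r * (a^2+1) := by rw [← this]; ring
      ring_nf
      simp only [h4, h3, this]
      ring
    · apply Continuous.continuousOn
      have := Real.continuous_arcsin
      fun_prop
    · intro u hu
      have hw1 : a < 1 + u := by linarith [hu.1]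
      have hw2 : 1 + u < r := by linarith [hu.2]
      have hc0 : 0 < r^2 - (1+u)^2 := by nlinarith
      have hc1 : r^2 - (1+u)^2 ≤ 1 := by nlinarith
      have hs : 0 < √(r^2 - (1+u)^2) := Real.sqrt_pos.mpr hc0
      have hs2 := Real.sq_sqrt hc0.le
      have dw : HasDerivAt (fun u : ℝ => 1 + u) 1 u := (hasDerivAt_id u).const_add 1
      have dsq := ((dw.pow 2).const_sub (r^2)).sqrt hc0.ne'
      have das : HasDerivAt (fun u : ℝ => Real.arcsin ((1+u)/r)) (1 / √(r^2-(1+u)^2)) u := by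
        have h := (Real.hasDerivAt_arcsin (x := (1+u)/r)
          (by have : 0 < (1+u)/r := by apply div_pos <;> linarith
              linarith)
          (by have : (1+u)/r < 1 := by rw [div_lt_one hrpos]; exact hw2
              exact this.ne)).comp u (dw.div_const r)
        refine HasDerivAt.congr_deriv h ?_
        rw [show 1 - ((1+u)/r)^2 = (r^2-(1+u)^2)/r^2 by field_simp, Real.sqrt_div hc0.le,
          Real.sqrt_sq hrpos.le]
        field_simp
      have hd := ((((((dw.mul dsq).add (das.const_mul (r^2))).const_mul 2).add
        ((dsq.pow 3).const_mul (2/3))).sub (dw.const_mul (2*r^2))).add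
        ((dw.pow 3).const_mul (2/3))).add (((dw.pow 2).const_mul (r^2)).div_const 2) |>.sub
        ((dw.pow 4).div_const 4)
      refine hd.congr_deriv ?_
      simp only [hF, Pi.pow_apply]
      rw [min_eq_left hc1, abs_of_nonneg (by linarith)]
      set s := √(r^2 - (1+u)^2) with hsdef
      have hr2' : r^2 = s^2 + (1+u)^2 := by linarith
      rw [hr2']
      field_simp
      push_cast
      ring
  rw [h1, h2, h3, h4, intervalIntegral.integral_add (by simp) (by simp),
    intervalIntegral.integral_sub (by simp) (by simp)]
  simp
  linarith

/-- Equation (A.12): for `√2 ≤ r ≤ 2`, the probability that a point uniform in the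
unit square and a point uniform in the horizontally adjacent unit square are within
normalized distance `r` equals
`−11/12 + 2√(r²−1) − r²/2 + 2r² arcsin(1/r) + (4/3)((r²−1)^(3/2) − r³)`. -/
theorem adjacent_square_distance_cdf_mid (r : ℝ) (hr0 : Real.sqrt 2 ≤ r) (hr1 : r ≤ 2) :
    volume {p : ℝ × ℝ × ℝ × ℝ |
        p.1 ∈ Set.Icc (0 : ℝ) 1 ∧ p.2.1 ∈ Set.Icc (0 : ℝ) 1 ∧
        p.2.2.1 ∈ Set.Icc (0 : ℝ) 1 ∧ p.2.2.2 ∈ Set.Icc (0 : ℝ) 1 ∧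
        (1 + p.2.2.1 - p.1) ^ 2 + (p.2.1 - p.2.2.2) ^ 2 ≤ r ^ 2} =
      ENNReal.ofReal (-11 / 12 + 2 * Real.sqrt (r ^ 2 - 1) - r ^ 2 / 2 +
        2 * r ^ 2 * Real.arcsin (1 / r) +
        4 / 3 * ((r ^ 2 - 1) ^ ((3 : ℝ) / 2) - r ^ 3)) := by
  rw [← aux_real r hr0 hr1]
  set μ : Measure ℝ := volume.restrict (Set.Icc (0:ℝ) 1) with hμ
  set K : Set (ℝ × ℝ) := {q | (1 + q.1)^2 + q.2^2 ≤ r^2} with hK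
  have hKm : MeasurableSet K := by
    apply IsClosed.measurableSet
    exact isClosed_le (by fun_prop) (by fun_prop)
  set k : ℝ × ℝ → ENNReal := K.indicator 1 with hk
  have hkm : Measurable k := measurable_one.indicator hKm
  have hkm2 : Measurable (fun p : ℝ × ℝ × ℝ × ℝ => k (p.2.2.1 - p.1, p.2.2.2 - p.2.1)) := by
    fun_prop
  have step1 : volume {p : ℝ × ℝ × ℝ × ℝ |
        p.1 ∈ Set.Icc (0 : ℝ) 1 ∧ p.2.1 ∈ Set.Icc (0 : ℝ) 1 ∧
        p.2.2.1 ∈ Set.Icc (0 : ℝ) 1 ∧ p.2.2.2 ∈ Set.Icc (0 : ℝ) 1 ∧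
        (1 + p.2.2.1 - p.1) ^ 2 + (p.2.1 - p.2.2.2) ^ 2 ≤ r ^ 2}
      = ∫⁻ p, k (p.2.2.1 - p.1, p.2.2.2 - p.2.1) ∂(μ.prod (μ.prod (μ.prod μ))) := by
    rw [hμ, Measure.prod_restrict, Measure.prod_restrict, Measure.prod_restrict,
      ← Measure.volume_eq_prod, ← Measure.volume_eq_prod, ← Measure.volume_eq_prod]
    have hset : MeasurableSet {p : ℝ × ℝ × ℝ × ℝ | (p.2.2.1 - p.1, p.2.2.2 - p.2.1) ∈ K} :=
      (show Measurable (fun p : ℝ × ℝ × ℝ × ℝ => (p.2.2.1 - p.1, p.2.2.2 - p.2.1)) by fun_prop) hKm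
    have : (fun p : ℝ × ℝ × ℝ × ℝ => k (p.2.2.1 - p.1, p.2.2.2 - p.2.1))
        = {p : ℝ × ℝ × ℝ × ℝ | (p.2.2.1 - p.1, p.2.2.2 - p.2.1) ∈ K}.indicator 1 := by
      funext p; simp [hk, Set.indicator_apply]
    rw [this, lintegral_indicator_one hset, Measure.restrict_apply hset]
    congr 1
    ext ⟨x1, y1, x2, y2⟩
    have e : (1 + x2 - x1) ^ 2 + (y1 - y2) ^ 2 = (1 + (x2 - x1))^2 + (y2 - y1)^2 := by ring
    simp only [Set.mem_ofPred_eq, Set.mem_inter_iff, Set.mem_prod, hK, e]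
    tauto
  have step2 : ∫⁻ p, k (p.2.2.1 - p.1, p.2.2.2 - p.2.1) ∂(μ.prod (μ.prod (μ.prod μ)))
      = ∫⁻ x1, ∫⁻ x2, ∫⁻ y1, ∫⁻ y2, k (x2 - x1, y2 - y1) ∂μ ∂μ ∂μ ∂μ := by
    rw [lintegral_prod _ hkm2.aemeasurable]
    refine lintegral_congr fun x1 => ?_
    rw [lintegral_prod _ (by fun_prop)]
    rw [← lintegral_lintegral_swap (μ := μ) (ν := μ)
      (f := fun y1 x2 => ∫⁻ y2, k (x2 - x1, y2 - y1) ∂μ)]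
    · refine lintegral_congr fun y1 => ?_
      rw [lintegral_prod _ (by fun_prop)]
    · apply Measurable.aemeasurable
      unfold Function.uncurry
      refine Measurable.lintegral_prod_right' (f := fun q : (ℝ × ℝ) × ℝ => k (q.1.2 - x1, q.2 - q.1.1)) ?_
      fun_prop
  have step3 : ∀ u : ℝ, ∫⁻ y1, ∫⁻ y2, k (u, y2 - y1) ∂μ ∂μ = 
      ENNReal.ofReal (2 * √(min (r^2 - (1+u)^2) 1) - √(min (r^2 - (1+u)^2) 1) ^ 2) := by
    intro u
    rw [hμ, aux_tri (fun v => k (u, v)) (by fun_prop), ← aux_inner]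
    refine lintegral_congr fun v => ?_
    have : (u, v) ∈ K ↔ v ^ 2 ≤ r^2 - (1+u)^2 := by
      simp only [hK, Set.mem_ofPred_eq]
      constructor <;> intro h <;> linarith
    simp [hk, Set.indicator_apply, this]
  rw [step1, step2]
  simp_rw [step3]
  have hcont : Continuous (fun u : ℝ => 2 * √(min (r^2 - (1+u)^2) 1) - √(min (r^2 - (1+u)^2) 1) ^ 2) := by
    fun_prop
  rw [hμ, aux_tri (fun u => ENNReal.ofReal (2 * √(min (r^2 - (1+u)^2) 1) - √(min (r^2 - (1+u)^2) 1) ^ 2))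
    (by fun_prop)]
  rw [intervalIntegral.integral_of_le (by norm_num), ofReal_integral_eq_lintegral_ofReal,
    ← lintegral_indicator measurableSet_Ioc]
  · refine lintegral_congr fun u => ?_
    by_cases hu : u ∈ Set.Ioc (-1:ℝ) 1
    · rw [Set.indicator_of_mem hu, ENNReal.ofReal_mul]
      have := abs_le.mpr ⟨hu.1.le, hu.2⟩
      linarith
    · rw [Set.indicator_of_notMem hu, ENNReal.ofReal_of_nonpos, zero_mul]
      by_contra h
      push Not at h
      have := abs_lt.mp (show |u| < 1 by linarith)
      exact hu ⟨this.1, this.2.le⟩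
  · exact (Continuous.integrableOn_Icc (by fun_prop)).mono_set Set.Ioc_subset_Icc_self
  · refine (ae_restrict_mem measurableSet_Ioc).mono fun u hu => ?_
    have h1 : |u| ≤ 1 := abs_le.mpr ⟨hu.1.le, hu.2⟩
    have h2 : √(min (r^2 - (1+u)^2) 1) ≤ 1 := Real.sqrt_le_one.mpr (min_le_right _ _)
    have h3 : 0 ≤ √(min (r^2 - (1+u)^2) 1) := Real.sqrt_nonneg _
    apply mul_nonneg
    · linarith
    · nlinarith
end

section
/- For every real number r with r ≥ 1, ∫₀¹ (1 − v)(4√(r² − v²) − r² + v² − 2) dv = −11/12 + 2√(r² − 1) − r²/2 + 2 r² arcsin(1/r) + (4/3)((r² − 1)^{3/2} − r³). -/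
/-- The definite integral of equation (A.12):
`∫₀¹ (1 − v)(4√(r² − v²) − r² + v² − 2) dv
  = −11/12 + 2√(r²−1) − r²/2 + 2r² arcsin(1/r) + (4/3)((r²−1)^(3/2) − r³)`
for every `r ≥ 1`. -/
theorem integral_cdf_mid (r : ℝ) (hr : 1 ≤ r) :
    ∫ v in (0 : ℝ)..1,
        (1 - v) * (4 * Real.sqrt (r ^ 2 - v ^ 2) - r ^ 2 + v ^ 2 - 2) =
      -11 / 12 + 2 * Real.sqrt (r ^ 2 - 1) - r ^ 2 / 2 +
        2 * r ^ 2 * Real.arcsin (1 / r) +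
        4 / 3 * ((r ^ 2 - 1) ^ ((3 : ℝ) / 2) - r ^ 3) := by
  have hr0 : 0 < r := by linarith
  have hpow : (r ^ 2 - 1) ^ ((3 : ℝ) / 2) = (r ^ 2 - 1) * Real.sqrt (r ^ 2 - 1) := by
    have h0 : 0 ≤ r ^ 2 - 1 := by nlinarith
    rw [show (3 : ℝ) / 2 = 1 + 1 / 2 by norm_num,
      Real.rpow_add_of_nonneg h0 (by norm_num) (by norm_num), Real.rpow_one, Real.sqrt_eq_rpow]
  have key := intervalIntegral.integral_eq_sub_of_hasDerivAt_of_le (a := (0 : ℝ)) (b := 1)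
    (f := fun v => 2 * (v * Real.sqrt (r ^ 2 - v ^ 2)) + 2 * r ^ 2 * Real.arcsin (v / r)
      + 4 / 3 * ((r ^ 2 - v ^ 2) * Real.sqrt (r ^ 2 - v ^ 2))
      + ((v ^ 3 / 3 - v ^ 4 / 4) - (r ^ 2 + 2) * (v - v ^ 2 / 2)))
    (f' := fun v => (1 - v) * (4 * Real.sqrt (r ^ 2 - v ^ 2) - r ^ 2 + v ^ 2 - 2))
    zero_le_one ?_ ?_ ?_
  · rw [key, hpow]
    simp [Real.sqrt_sq hr0.le]
    ring
  · apply Continuous.continuousOn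
    have := Real.continuous_arcsin.comp (continuous_id.div_const r)
    simp only [Function.comp_def, id] at this
    fun_prop
  · intro v hv
    obtain ⟨h0, h1⟩ := hv
    have hpos : 0 < r ^ 2 - v ^ 2 := by nlinarith
    have hs : 0 < Real.sqrt (r ^ 2 - v ^ 2) := Real.sqrt_pos.2 hpos
    have hss : Real.sqrt (r ^ 2 - v ^ 2) ^ 2 = r ^ 2 - v ^ 2 := Real.sq_sqrt hpos.le
    have hq : HasDerivAt (fun v : ℝ => r ^ 2 - v ^ 2) (-(2 * v)) v := by
      simpa using ((hasDerivAt_id v).pow 2).const_sub (r ^ 2)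
    have hS := hq.sqrt hpos.ne'
    have hlt : v / r < 1 := by rw [div_lt_one hr0]; linarith
    have hgt : 0 < v / r := by positivity
    have hA := (Real.hasDerivAt_arcsin (x := v / r) (by linarith) (by linarith)).comp v
      ((hasDerivAt_id v).div_const r)
    have hsq : Real.sqrt (1 - (v / r) ^ 2) = Real.sqrt (r ^ 2 - v ^ 2) / r := by
      rw [show 1 - (v / r) ^ 2 = (r ^ 2 - v ^ 2) / r ^ 2 by field_simp,
        Real.sqrt_div hpos.le, Real.sqrt_sq hr0.le]
    rw [hsq] at hA
    have hP : HasDerivAt (fun v : ℝ => (v ^ 3 / 3 - v ^ 4 / 4) - (r ^ 2 + 2) * (v - v ^ 2 / 2))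
        ((3 * v ^ 2 / 3 - 4 * v ^ 3 / 4) - (r ^ 2 + 2) * (1 - 2 * v / 2)) v := by
      have a2 := hasDerivAt_pow 2 v
      have a3 := hasDerivAt_pow 3 v
      have a4 := hasDerivAt_pow 4 v
      refine HasDerivAt.congr_deriv (((a3.div_const 3).sub (a4.div_const 4)).sub
        (((hasDerivAt_id v).sub (a2.div_const 2)).const_mul (r ^ 2 + 2))) ?_
      norm_num
    have hF := (((((hasDerivAt_id v).mul hS).const_mul 2).add (hA.const_mul (2 * r ^ 2))).add
      ((hq.mul hS).const_mul (4 / 3))).add hP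
    refine hF.congr_deriv ?_
    simp only [id]
    set s := Real.sqrt (r ^ 2 - v ^ 2) with hsdef
    have hr2 : r ^ 2 = s ^ 2 + v ^ 2 := by linarith
    rw [hr2]
    field_simp
    ring_nf
    try (rw [hr2]; ring)
  · apply Continuous.intervalIntegrable
    fun_prop
end
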